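/- arXiv:2104.10202 — 2 statements merged into one kernel-verified Lean document; each statement's English description precedes it below -/
import Mathlib

section
/- (Koksma's General Metric Theorem) If K > 0 and the sequence of functions (u_n)_{n≥1}, u_n : [0,1] → ℝ, is K-Koksma, then for Lebesgue-almost every x ∈ [0,1] the sequence of reals (u_n(x))_{n≥1} is uniformly distributed modulo 1. -/
open MeasureTheory Filter Finset
open scoped Classical

/-- `e(x) = e^{2πix}`. -/
noncomputable def expi (x : ℝ) : ℂ := Complex.exp (2 * Real.pi * Complex.I * x)

/-- `S_N(y) = (1/N) ∑_{j=1}^N e(y_j)`. -/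
noncomputable def weylSum (y : ℕ → ℝ) (N : ℕ) : ℂ :=
  (1 / (N : ℂ)) * ∑ j ∈ Finset.Icc 1 N, expi (y j)

/-- `(x_n)_{n≥1}` is uniformly distributed modulo 1. -/
def UDMod1 (x : ℕ → ℝ) : Prop :=
  ∀ a b : ℝ, 0 ≤ a → a < b → b ≤ 1 →
    Tendsto (fun N : ℕ =>
        (((Finset.Icc 1 N).filter (fun n => Int.fract (x n) ∈ Set.Ico a b)).card : ℝ) / N)
      atTop (nhds (b - a))

/-- `(u_n)` is a `K`-Koksma sequence of functions on `[0,1]`. -/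
def IsKoksma (K : ℝ) (u : ℕ → ℝ → ℝ) : Prop :=
  ∃ u' : ℕ → ℝ → ℝ,
    (∀ n, ∀ x ∈ Set.Icc (0:ℝ) 1, HasDerivWithinAt (u n) (u' n x) (Set.Icc 0 1) x) ∧
    (∀ n, ContinuousOn (u' n) (Set.Icc (0:ℝ) 1)) ∧
    (∀ m n, MonotoneOn (fun x => u' m x - u' n x) (Set.Icc (0:ℝ) 1) ∨
            AntitoneOn (fun x => u' m x - u' n x) (Set.Icc (0:ℝ) 1)) ∧
    (∀ m n, m ≠ n → ∀ x ∈ Set.Icc (0:ℝ) 1, K ≤ |u' m x - u' n x|)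

/-- `(x_n)_{n≥1}` is `C`-uniformly distributed. -/
def CUD (C : Set (Set ℝ)) (x : ℕ → ℝ) : Prop :=
  ∀ A ∈ C,
    Tendsto (fun N : ℕ =>
        (((Finset.Icc 1 N).filter (fun n => Int.fract (x n) ∈ A)).card : ℝ) / N)
      atTop (nhds (volume A).toReal)

theorem norm_integral_mul_deriv_sub_le_of_monotoneOn {a b M : ℝ} (hab : a ≤ b) {w : ℝ → ℝ}
    {F f : ℝ → ℂ} (hw : ContinuousOn w (Set.Icc a b)) (hmono : MonotoneOn w (Set.Icc a b))
    (hF : ContinuousOn F (Set.Icc a b)) (hF' : ∀ x ∈ Set.Ioo a b, HasDerivAt F (f x) x)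
    (hf : ContinuousOn f (Set.Icc a b)) (hM : ∀ x ∈ Set.Icc a b, ‖F x‖ ≤ M) :
    ‖(∫ x in a..b, (w x : ℂ) * f x) - (w b * F b - w a * F a)‖ ≤ M * (w b - w a) := by
  obtain ⟨L, hL⟩ := isCompact_Icc.exists_bound_of_continuousOn hf
  have hwf : ContinuousOn (fun x => (w x : ℂ) * f x) (Set.Icc a b) :=
    (Complex.continuous_ofReal.comp_continuousOn hw).mul hf
  have step : ∀ s t, a ≤ s → s ≤ t → t ≤ b →
      ‖(∫ x in s..t, (w x : ℂ) * f x) - (w t * F t - w s * F s)‖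
        ≤ (M + L * (t - s)) * (w t - w s) := by
    intro s t has hst htb
    have hsub : Set.Icc s t ⊆ Set.Icc a b := Set.Icc_subset_Icc has htb
    have hs : s ∈ Set.Icc a b := ⟨has, hst.trans htb⟩
    have ht : t ∈ Set.Icc a b := ⟨has.trans hst, htb⟩
    have hif : IntervalIntegrable f volume s t :=
      (hf.mono hsub).intervalIntegrable_of_Icc hst
    have hiwf : IntervalIntegrable (fun x => (w x : ℂ) * f x) volume s t :=
      (hwf.mono hsub).intervalIntegrable_of_Icc hst
    have hFTC : ∫ x in s..t, f x = F t - F s :=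
      intervalIntegral.integral_eq_sub_of_hasDerivAt_of_le hst (hF.mono hsub)
        (fun x hx => hF' x ⟨has.trans_lt hx.1, hx.2.trans_le htb⟩) hif
    have key : (∫ x in s..t, (w x : ℂ) * f x) - (w t * F t - w s * F s)
        = (∫ x in s..t, ((w x : ℂ) - w t) * f x) - ((w t : ℂ) - w s) * F s := by
      simp only [sub_mul]
      rw [intervalIntegral.integral_sub hiwf (hif.const_mul _),
        intervalIntegral.integral_const_mul, hFTC]
      ring
    have h1 : ‖∫ x in s..t, ((w x : ℂ) - w t) * f x‖ ≤ ((w t - w s) * L) * |t - s| := by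
      refine intervalIntegral.norm_integral_le_of_norm_le_const fun x hx => ?_
      rw [Set.uIoc_of_le hst] at hx
      have hx' : x ∈ Set.Icc a b := hsub ⟨hx.1.le, hx.2⟩
      have h2 := hmono hx' ht hx.2
      have h3 := hmono hs hx' hx.1.le
      rw [norm_mul, ← Complex.ofReal_sub, Complex.norm_real, Real.norm_eq_abs, abs_of_nonpos (by linarith)]
      exact mul_le_mul (by linarith) (hL x hx') (norm_nonneg _) (by linarith)
    have h4 : ‖((w t : ℂ) - w s) * F s‖ ≤ (w t - w s) * M := by
      rw [norm_mul, ← Complex.ofReal_sub, Complex.norm_real, Real.norm_eq_abs,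
        abs_of_nonneg (sub_nonneg.2 (hmono hs ht hst))]
      exact mul_le_mul_of_nonneg_left (hM s hs) (sub_nonneg.2 (hmono hs ht hst))
    rw [key]
    rw [abs_of_nonneg (sub_nonneg.2 hst)] at h1
    calc _ ≤ _ := norm_sub_le _ _
      _ ≤ _ := add_le_add h1 h4
      _ = _ := by ring
  have bound : ∀ n : ℕ,
      ‖(∫ x in a..b, (w x : ℂ) * f x) - (w b * F b - w a * F a)‖
        ≤ (M + L * ((b - a) * (1 / ((n : ℝ) + 1)))) * (w b - w a) := by
    intro n
    have hn : (0 : ℝ) < (n : ℝ) + 1 := by positivity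
    set t : ℕ → ℝ := fun i => a + (b - a) * (i / ((n : ℝ) + 1)) with ht
    have ht0 : t 0 = a := by simp [ht]
    have htn : t (n + 1) = b := by simp [ht, div_self hn.ne']
    have hsucc : ∀ i, t (i + 1) - t i = (b - a) * (1 / ((n : ℝ) + 1)) := by
      intro i; simp only [ht]; push_cast; ring
    have htmono : Monotone t := monotone_nat_of_le_succ fun i => by
      have := hsucc i
      have : 0 ≤ (b - a) * (1 / ((n : ℝ) + 1)) := mul_nonneg (sub_nonneg.2 hab) (by positivity)
      linarith
    have hmem : ∀ i, i ≤ n + 1 → t i ∈ Set.Icc a b := fun i hi =>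
      ⟨ht0 ▸ htmono (Nat.zero_le i), htn ▸ htmono hi⟩
    have hint : ∀ i < n + 1, IntervalIntegrable (fun x => (w x : ℂ) * f x) volume (t i) (t (i + 1)) :=
      fun i hi => (hwf.mono (Set.Icc_subset_Icc (hmem i hi.le).1
        (hmem (i + 1) hi).2)).intervalIntegrable_of_Icc (htmono i.le_succ)
    have h1 := intervalIntegral.sum_integral_adjacent_intervals hint
    have h2 := Finset.sum_range_sub (fun i => (w (t i) : ℂ) * F (t i)) (n + 1)
    have h3 := Finset.sum_range_sub (fun i => w (t i)) (n + 1)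
    rw [ht0, htn] at h1 h2 h3
    rw [← h1, ← h2, ← Finset.sum_sub_distrib, ← h3, Finset.mul_sum]
    refine (norm_sum_le _ _).trans (Finset.sum_le_sum fun i hi => ?_)
    have hi' := Finset.mem_range.1 hi
    rw [← hsucc i]
    exact step _ _ (hmem i hi'.le).1 (htmono i.le_succ) (hmem (i + 1) hi').2
  have hlim : Tendsto (fun n : ℕ => (M + L * ((b - a) * (1 / ((n : ℝ) + 1)))) * (w b - w a)) atTop
      (nhds ((M + L * ((b - a) * 0)) * (w b - w a))) :=
    ((((tendsto_one_div_add_atTop_nhds_zero_nat (𝕜 := ℝ)).const_mul _).const_mul _).const_add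
      _).mul_const _
  simpa using ge_of_tendsto' hlim bound

theorem norm_integral_mul_deriv_sub_le {a b M : ℝ} (hab : a ≤ b) {w : ℝ → ℝ} {F f : ℝ → ℂ}
    (hw : ContinuousOn w (Set.Icc a b))
    (hmono : MonotoneOn w (Set.Icc a b) ∨ AntitoneOn w (Set.Icc a b))
    (hF : ContinuousOn F (Set.Icc a b)) (hF' : ∀ x ∈ Set.Ioo a b, HasDerivAt F (f x) x)
    (hf : ContinuousOn f (Set.Icc a b)) (hM : ∀ x ∈ Set.Icc a b, ‖F x‖ ≤ M) :
    ‖(∫ x in a..b, (w x : ℂ) * f x) - (w b * F b - w a * F a)‖ ≤ M * |w b - w a| := by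
  have ha : a ∈ Set.Icc a b := ⟨le_rfl, hab⟩
  have hb : b ∈ Set.Icc a b := ⟨hab, le_rfl⟩
  rcases hmono with h | h
  · rw [abs_of_nonneg (sub_nonneg.2 (h ha hb hab))]
    exact norm_integral_mul_deriv_sub_le_of_monotoneOn hab hw h hF hF' hf hM
  · have := norm_integral_mul_deriv_sub_le_of_monotoneOn (w := fun x => -w x) hab hw.neg h.neg
      hF hF' hf hM
    simp only [Complex.ofReal_neg, neg_mul, intervalIntegral.integral_neg] at this
    rw [abs_of_nonpos (sub_nonpos.2 (h ha hb hab)), ← norm_neg]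
    calc _ = _ := by congr 1; ring
      _ ≤ _ := this
      _ = _ := by ring

theorem forall_pos_or_forall_neg_of_continuousOn {s : Set ℝ} (hs : IsPreconnected s) {g : ℝ → ℝ}
    (hg : ContinuousOn g s) (h0 : ∀ x ∈ s, g x ≠ 0) :
    (∀ x ∈ s, 0 < g x) ∨ (∀ x ∈ s, g x < 0) := by
  by_contra! h
  obtain ⟨⟨x, hx, hgx⟩, y, hy, hgy⟩ := h
  obtain ⟨z, hz, hz0⟩ := hs.intermediate_value hx hy hg ⟨hgx, hgy⟩
  exact h0 z hz hz0

theorem inv_monotoneOn_or_antitoneOn {s : Set ℝ} (hs : IsPreconnected s) {g : ℝ → ℝ}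
    (hg : ContinuousOn g s) (h0 : ∀ x ∈ s, g x ≠ 0) (hmono : MonotoneOn g s ∨ AntitoneOn g s) :
    MonotoneOn (fun x => (g x)⁻¹) s ∨ AntitoneOn (fun x => (g x)⁻¹) s := by
  rcases forall_pos_or_forall_neg_of_continuousOn hs hg h0 with hp | hn
  · rcases hmono with h | h
    · exact Or.inr fun x hx y hy hxy => inv_anti₀ (hp x hx) (h hx hy hxy)
    · exact Or.inl fun x hx y hy hxy => inv_anti₀ (hp y hy) (h hx hy hxy)
  · rcases hmono with h | h
    · exact Or.inr fun x hx y hy hxy => (inv_le_inv_of_neg (hn y hy) (hn x hx)).2 (h hx hy hxy)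
    · exact Or.inl fun x hx y hy hxy => (inv_le_inv_of_neg (hn x hx) (hn y hy)).2 (h hx hy hxy)

theorem continuous_expi : Continuous expi := by unfold expi; fun_prop

theorem norm_expi (x : ℝ) : ‖expi x‖ = 1 := by
  have : expi x = Complex.exp ((2 * Real.pi * x : ℝ) * Complex.I) := by
    unfold expi; congr 1; push_cast; ring
  rw [this, Complex.norm_exp_ofReal_mul_I]

theorem expi_sub (x y : ℝ) : expi (x - y) = expi x * (starRingEnd ℂ) (expi y) := by
  unfold expi
  rw [← Complex.exp_conj, ← Complex.exp_add]
  congr 1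
  simp only [map_mul, Complex.conj_ofReal, Complex.conj_I, Complex.conj_ofNat, Complex.ofReal_sub]
  ring

/-- Van der Corput's first-derivative estimate. -/
theorem norm_integral_expi_le {a b : ℝ} (hab : a ≤ b) {φ g : ℝ → ℝ}
    (hφ : ∀ x ∈ Set.Icc a b, HasDerivWithinAt φ (g x) (Set.Icc a b) x)
    (hg : ContinuousOn g (Set.Icc a b)) (h0 : ∀ x ∈ Set.Icc a b, g x ≠ 0)
    (hmono : MonotoneOn g (Set.Icc a b) ∨ AntitoneOn g (Set.Icc a b)) :
    ‖∫ x in a..b, expi (φ x)‖ ≤ |g a|⁻¹ + |g b|⁻¹ := by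
  have hφc : ContinuousOn φ (Set.Icc a b) := fun x hx => (hφ x hx).continuousWithinAt
  have hec : ContinuousOn (fun x => expi (φ x)) (Set.Icc a b) :=
    continuous_expi.comp_continuousOn hφc
  have hc : (2 * Real.pi * Complex.I : ℂ) ≠ 0 := by simp [Real.pi_ne_zero]
  have hnorm : ‖(2 * Real.pi * Complex.I : ℂ)⁻¹‖ ≤ 1 / 2 := by
    rw [norm_inv]
    simp only [norm_mul, Complex.norm_I, Complex.norm_real, Real.norm_eq_abs,
      abs_of_pos Real.pi_pos, Complex.norm_ofNat, mul_one]
    rw [one_div]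
    exact inv_anti₀ (by norm_num) (by linarith [Real.pi_gt_three])
  have hM : ∀ x, ‖(2 * Real.pi * Complex.I : ℂ)⁻¹ * expi (φ x)‖ ≤ 1 / 2 := fun x => by
    rw [norm_mul, norm_expi, mul_one]; exact hnorm
  have hgc : ContinuousOn (fun x => (g x : ℂ)) (Set.Icc a b) :=
    Complex.continuous_ofReal.comp_continuousOn hg
  have key := norm_integral_mul_deriv_sub_le (M := 1 / 2) hab
    (w := fun x => (g x)⁻¹) (F := fun x => (2 * Real.pi * Complex.I : ℂ)⁻¹ * expi (φ x))
    (f := fun x => (g x : ℂ) * expi (φ x)) (hg.inv₀ h0)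
    (inv_monotoneOn_or_antitoneOn isPreconnected_Icc hg h0 hmono)
    (continuousOn_const.mul hec)
    (fun x hx => by
      have h1 : HasDerivAt φ (g x) x :=
        (hφ x (Set.Ioo_subset_Icc_self hx)).hasDerivAt (Icc_mem_nhds hx.1 hx.2)
      have h2 := (((h1.ofReal_comp).const_mul (2 * Real.pi * Complex.I : ℂ)).cexp).const_mul
        (2 * Real.pi * Complex.I : ℂ)⁻¹
      refine h2.congr_deriv ?_
      unfold expi
      field_simp)
    (hgc.mul hec) (fun x _ => hM x)
  have hcongr : ∫ x in a..b, (((g x)⁻¹ : ℝ) : ℂ) * ((g x : ℂ) * expi (φ x))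
      = ∫ x in a..b, expi (φ x) := by
    refine intervalIntegral.integral_congr fun x hx => ?_
    rw [Set.uIcc_of_le hab] at hx
    have : (g x : ℂ) ≠ 0 := by exact_mod_cast h0 x hx
    push_cast
    field_simp
  rw [hcongr] at key
  have hend : ∀ x, ‖(((g x)⁻¹ : ℝ) : ℂ) * ((2 * Real.pi * Complex.I : ℂ)⁻¹ * expi (φ x))‖
      ≤ |g x|⁻¹ * (1 / 2) := fun x => by
    rw [norm_mul, Complex.norm_real, Real.norm_eq_abs, abs_inv]
    exact mul_le_mul_of_nonneg_left (hM x) (by positivity)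
  have h3 := norm_sub_norm_le (∫ x in a..b, expi (φ x)) 
    ((((g b)⁻¹ : ℝ) : ℂ) * ((2 * Real.pi * Complex.I : ℂ)⁻¹ * expi (φ b)) -
      (((g a)⁻¹ : ℝ) : ℂ) * ((2 * Real.pi * Complex.I : ℂ)⁻¹ * expi (φ a)))
  have h4 := norm_sub_le ((((g b)⁻¹ : ℝ) : ℂ) * ((2 * Real.pi * Complex.I : ℂ)⁻¹ * expi (φ b)))
      ((((g a)⁻¹ : ℝ) : ℂ) * ((2 * Real.pi * Complex.I : ℂ)⁻¹ * expi (φ a)))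
  have h5 := abs_sub (g b)⁻¹ (g a)⁻¹
  rw [abs_inv, abs_inv] at h5
  linarith [hend a, hend b]

theorem sum_inv_sq_le_of_separated {K : ℝ} (hK : 0 < K) {a : ℕ → ℝ}
    (ha : ∀ m n, m ≠ n → K ≤ |a m - a n|) (m : ℕ) (S : Finset ℕ) :
    ∑ n ∈ S.erase m, (|a m - a n| ^ 2)⁻¹ ≤ 4 / K ^ 2 * ∑' j : ℤ, 1 / (j : ℝ) ^ 2 := by
  have hsum : Summable fun j : ℤ => 1 / (j : ℝ) ^ 2 :=
    Real.summable_one_div_int_pow.2 one_lt_two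
  set f : ℕ → ℤ := fun n => ⌊(a n - a m) / K⌋ with hf
  have hinj : Function.Injective f := by
    intro n l hnl
    by_contra hne
    have h1 := ha n l hne
    have h2 := Int.abs_sub_lt_one_of_floor_eq_floor hnl
    rw [← sub_div, sub_sub_sub_cancel_right, abs_div, abs_of_pos hK, div_lt_one hK] at h2
    linarith
  have hbound : ∀ n, n ≠ m → (|a m - a n| ^ 2)⁻¹ ≤ 4 / K ^ 2 * (1 / (f n : ℝ) ^ 2) := by
    intro n hn
    have h1 := ha n m hn
    have hfn : (f n : ℝ) ≠ 0 := by
      have hfm : f m = 0 := by simp [hf]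
      exact Int.cast_ne_zero.2 (hfm ▸ hinj.ne hn)
    have h2 := Int.floor_le ((a n - a m) / K)
    have h3 := Int.lt_floor_add_one ((a n - a m) / K)
    have h4 : |(f n : ℝ)| * K ≤ 2 * |a m - a n| := by
      rw [le_div_iff₀ hK] at h2
      rw [div_lt_iff₀ hK] at h3
      rw [abs_sub_comm (a m)]
      change (f n : ℝ) * K ≤ _ at h2
      change _ < ((f n : ℝ) + 1) * K at h3
      rcases abs_cases (a n - a m) with h | h <;> rcases abs_cases (f n : ℝ) with h' | h' <;>
        nlinarith
    have h5 : 0 < |(f n : ℝ)| * K := by positivity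
    have h6 : (f n : ℝ) ^ 2 * K ^ 2 / 4 ≤ |a m - a n| ^ 2 := by
      have := pow_le_pow_left₀ h5.le h4 2
      rw [mul_pow, sq_abs] at this
      linarith
    calc _ ≤ ((f n : ℝ) ^ 2 * K ^ 2 / 4)⁻¹ := inv_anti₀ (by positivity) h6
      _ = _ := by field_simp
  calc _ ≤ ∑ n ∈ S.erase m, 4 / K ^ 2 * (1 / (f n : ℝ) ^ 2) :=
        Finset.sum_le_sum fun n hn => hbound n (Finset.ne_of_mem_erase hn)
    _ = 4 / K ^ 2 * ∑ n ∈ S.erase m, 1 / (f n : ℝ) ^ 2 := by rw [Finset.mul_sum]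
    _ ≤ 4 / K ^ 2 * ∑' n, 1 / (f n : ℝ) ^ 2 := by
        refine mul_le_mul_of_nonneg_left ?_ (by positivity)
        exact (hsum.comp_injective hinj).sum_le_tsum _ fun _ _ => by positivity
    _ ≤ _ := by
        refine mul_le_mul_of_nonneg_left ?_ (by positivity)
        exact tsum_comp_le_tsum_of_inj hsum (fun _ => by positivity) hinj

theorem integral_norm_sum_expi_sq_le {a b : ℝ} (hab : a ≤ b) {u : ℕ → ℝ → ℝ}
    (hu : ∀ n, ContinuousOn (u n) (Set.Icc a b)) (S : Finset ℕ) :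
    ∫ x in a..b, ‖∑ j ∈ S, expi (u j x)‖ ^ 2
      ≤ ∑ m ∈ S, ∑ n ∈ S, ‖∫ x in a..b, expi (u m x - u n x)‖ := by
  have hint : ∀ m n, IntervalIntegrable (fun x => expi (u m x - u n x)) volume a b := fun m n =>
    (continuous_expi.comp_continuousOn ((hu m).sub (hu n))).intervalIntegrable_of_Icc hab
  have hsq : ∀ x, ((‖∑ j ∈ S, expi (u j x)‖ ^ 2 : ℝ) : ℂ)
      = ∑ m ∈ S, ∑ n ∈ S, expi (u m x - u n x) := fun x => by
    simp_rw [expi_sub, ← Finset.mul_sum]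
    rw [← Finset.sum_mul, ← map_sum, Complex.mul_conj']
    push_cast
    rfl
  have h1 : ((∫ x in a..b, ‖∑ j ∈ S, expi (u j x)‖ ^ 2 : ℝ) : ℂ)
      = ∑ m ∈ S, ∑ n ∈ S, ∫ x in a..b, expi (u m x - u n x) := by
    rw [← intervalIntegral.integral_ofReal]
    simp_rw [hsq]
    have hsum : ∀ m ∈ S, IntervalIntegrable (fun x => ∑ n ∈ S, expi (u m x - u n x)) volume a b :=
      fun m _ => by
        simpa only [Finset.sum_fn] using IntervalIntegrable.sum S fun n _ => hint m n
    rw [intervalIntegral.integral_finsetSum hsum]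
    exact Finset.sum_congr rfl fun m _ => intervalIntegral.integral_finsetSum fun n _ => hint m n
  calc _ ≤ ‖((∫ x in a..b, ‖∑ j ∈ S, expi (u j x)‖ ^ 2 : ℝ) : ℂ)‖ := by
        rw [Complex.norm_real]; exact Real.le_norm_self _
    _ ≤ _ := by
        rw [h1]
        exact (norm_sum_le _ _).trans (Finset.sum_le_sum fun m _ => norm_sum_le _ _)

theorem IsKoksma.continuousOn {K : ℝ} {u : ℕ → ℝ → ℝ} (hu : IsKoksma K u) (n : ℕ) :
    ContinuousOn (u n) (Set.Icc 0 1) := by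
  obtain ⟨u', hd, -⟩ := hu
  exact fun x hx => (hd n x hx).continuousWithinAt

theorem IsKoksma.const_mul {K : ℝ} {u : ℕ → ℝ → ℝ} (hu : IsKoksma K u) (c : ℝ) :
    IsKoksma (|c| * K) fun n x => c * u n x := by
  obtain ⟨u', hd, hc, hmono, hK⟩ := hu
  refine ⟨fun n x => c * u' n x, fun n x hx => (hd n x hx).const_mul c,
    fun n => continuousOn_const.mul (hc n), fun m n => ?_, fun m n hmn x hx => ?_⟩
  · simp only [← mul_sub]
    rcases le_total 0 c with h0 | h0 <;> rcases hmono m n with h | h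
    · exact Or.inl fun x hx y hy hxy => mul_le_mul_of_nonneg_left (h hx hy hxy) h0
    · exact Or.inr fun x hx y hy hxy => mul_le_mul_of_nonneg_left (h hx hy hxy) h0
    · exact Or.inr fun x hx y hy hxy => mul_le_mul_of_nonpos_left (h hx hy hxy) h0
    · exact Or.inl fun x hx y hy hxy => mul_le_mul_of_nonpos_left (h hx hy hxy) h0
  · rw [← mul_sub, abs_mul]
    exact mul_le_mul_of_nonneg_left (hK m n hmn x hx) (abs_nonneg c)

theorem IsKoksma.exists_integral_norm_sum_sq_le {K : ℝ} (hK : 0 < K) {u : ℕ → ℝ → ℝ}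
    (hu : IsKoksma K u) :
    ∃ C : ℝ, ∀ (S : Finset ℕ) (R : ℝ), 0 < R →
      ∫ x in (0 : ℝ)..1, ‖∑ j ∈ S, expi (u j x)‖ ^ 2 ≤ S.card * (1 + 2 * S.card / R + C * R) := by
  have huc := hu.continuousOn
  obtain ⟨u', hd, hc, hmono, hsep⟩ := hu
  set B : ℝ := 4 / K ^ 2 * ∑' j : ℤ, 1 / (j : ℝ) ^ 2
  refine ⟨2 * B, fun S R hR => (integral_norm_sum_expi_sq_le zero_le_one huc S).trans ?_⟩
  have hinv : ∀ d : ℝ, |d|⁻¹ ≤ 1 / R + R * (|d| ^ 2)⁻¹ := fun d => by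
    have h1 : 0 ≤ (1 - R * |d|⁻¹) ^ 2 / R := by positivity
    have h2 : 0 ≤ |d|⁻¹ := by positivity
    have h3 : (1 - R * |d|⁻¹) ^ 2 / R = 1 / R - 2 * |d|⁻¹ + R * (|d| ^ 2)⁻¹ := by
      rw [← inv_pow]; field_simp; ring
    linarith
  have hoff : ∀ m n, m ≠ n → ‖∫ x in (0 : ℝ)..1, expi (u m x - u n x)‖
      ≤ |u' m 0 - u' n 0|⁻¹ + |u' m 1 - u' n 1|⁻¹ := fun m n hmn =>
    norm_integral_expi_le zero_le_one (fun x hx => (hd m x hx).sub (hd n x hx))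
      ((hc m).sub (hc n))
      (fun x hx h0 => by have := hsep m n hmn x hx; rw [h0, abs_zero] at this; linarith)
      (hmono m n)
  have hrow : ∀ m ∈ S, ∑ n ∈ S, ‖∫ x in (0 : ℝ)..1, expi (u m x - u n x)‖
      ≤ 1 + 2 * S.card / R + 2 * B * R := by
    intro m hm
    rw [← Finset.add_sum_erase S _ hm]
    have h1 : ‖∫ x in (0 : ℝ)..1, expi (u m x - u m x)‖ ≤ 1 := by
      simp [norm_expi]
    have h2 : ∀ t ∈ Set.Icc (0 : ℝ) 1,
        ∑ n ∈ S.erase m, |u' m t - u' n t|⁻¹ ≤ S.card / R + R * B := by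
      intro t ht
      calc _ ≤ ∑ n ∈ S.erase m, (1 / R + R * (|u' m t - u' n t| ^ 2)⁻¹) :=
            Finset.sum_le_sum fun n _ => hinv _
        _ = (S.erase m).card / R + R * ∑ n ∈ S.erase m, (|u' m t - u' n t| ^ 2)⁻¹ := by
            rw [Finset.sum_add_distrib, ← Finset.mul_sum, Finset.sum_const, nsmul_eq_mul,
              mul_one_div]
        _ ≤ _ := by
            gcongr
            · exact Finset.erase_subset _ _
            · exact sum_inv_sq_le_of_separated hK (a := fun n => u' n t)
                (fun m n hmn => hsep m n hmn t ht) m S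
    have h3 : ∑ n ∈ S.erase m, ‖∫ x in (0 : ℝ)..1, expi (u m x - u n x)‖
        ≤ ∑ n ∈ S.erase m, |u' m 0 - u' n 0|⁻¹ + ∑ n ∈ S.erase m, |u' m 1 - u' n 1|⁻¹ := by
      rw [← Finset.sum_add_distrib]
      exact Finset.sum_le_sum fun n hn => hoff m n (Finset.ne_of_mem_erase hn).symm
    have h4 := h2 0 (by simp)
    have h5 := h2 1 (by simp)
    have h6 : 2 * (S.card : ℝ) / R = S.card / R + S.card / R := by ring
    linarith
  calc _ ≤ ∑ m ∈ S, (1 + 2 * (S.card : ℝ) / R + 2 * B * R) := Finset.sum_le_sum hrow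
    _ = _ := by rw [Finset.sum_const, nsmul_eq_mul]

theorem norm_weylSum_sq (y : ℕ → ℝ) (N : ℕ) :
    ‖weylSum y N‖ ^ 2 = ((N : ℝ) ^ 2)⁻¹ * ‖∑ j ∈ Finset.Icc 1 N, expi (y j)‖ ^ 2 := by
  simp [weylSum, mul_pow]

theorem IsKoksma.exists_integral_norm_weylSum_sq_le {K : ℝ} (hK : 0 < K) {u : ℕ → ℝ → ℝ}
    (hu : IsKoksma K u) :
    ∃ C : ℝ, ∀ k : ℕ,
      ∫ x in (0 : ℝ)..1, ‖weylSum (fun n => u n x) (k ^ 4)‖ ^ 2 ≤ C * (1 / (k : ℝ) ^ 2) := by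
  obtain ⟨C, hC⟩ := hu.exists_integral_norm_sum_sq_le hK
  refine ⟨3 + C, fun k => ?_⟩
  rcases Nat.eq_zero_or_pos k with rfl | hk
  · simp [weylSum]
  have hk1 : (1 : ℝ) ≤ k := by exact_mod_cast hk
  have hk2 : (1 : ℝ) ≤ (k : ℝ) ^ 2 := one_le_pow₀ hk1
  have h := hC (Finset.Icc 1 (k ^ 4)) ((k : ℝ) ^ 2) (by positivity)
  simp only [norm_weylSum_sq, intervalIntegral.integral_const_mul]
  rw [Nat.card_Icc, Nat.add_sub_cancel] at h
  push_cast at h ⊢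
  calc _ ≤ (((k : ℝ) ^ 4) ^ 2)⁻¹ *
        ((k : ℝ) ^ 4 * (1 + 2 * (k : ℝ) ^ 4 / (k : ℝ) ^ 2 + C * (k : ℝ) ^ 2)) := by gcongr
    _ ≤ (((k : ℝ) ^ 4) ^ 2)⁻¹ *
        ((k : ℝ) ^ 4 * ((k : ℝ) ^ 2 + 2 * (k : ℝ) ^ 4 / (k : ℝ) ^ 2 + C * (k : ℝ) ^ 2)) := by gcongr
    _ = _ := by field_simp; ring

theorem IsKoksma.ae_tendsto_weylSum_pow_four {K : ℝ} (hK : 0 < K) {u : ℕ → ℝ → ℝ}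
    (hu : IsKoksma K u) :
    ∀ᵐ x ∂(volume.restrict (Set.Icc (0:ℝ) 1)),
      Tendsto (fun k : ℕ => weylSum (fun n => u n x) (k ^ 4)) atTop (nhds 0) := by
  obtain ⟨C, hC⟩ := hu.exists_integral_norm_weylSum_sq_le hK
  set μ := volume.restrict (Set.Icc (0:ℝ) 1)
  have hcont : ∀ k : ℕ, ContinuousOn (fun x => ‖weylSum (fun n => u n x) (k ^ 4)‖ ^ 2)
      (Set.Icc (0:ℝ) 1) := fun k =>
    ((continuousOn_const.mul (continuousOn_finsetSum _ fun j _ =>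
      continuous_expi.comp_continuousOn (hu.continuousOn j))).norm).pow 2
  have hint : ∀ k : ℕ, Integrable (fun x => ‖weylSum (fun n => u n x) (k ^ 4)‖ ^ 2) μ := fun k =>
    (hcont k).integrableOn_compact isCompact_Icc
  have hmeas : ∀ k : ℕ,
      AEMeasurable (fun x => ENNReal.ofReal (‖weylSum (fun n => u n x) (k ^ 4)‖ ^ 2)) μ :=
    fun k => (hint k).aemeasurable.ennreal_ofReal
  have hfin : ∫⁻ x, ∑' k : ℕ, ENNReal.ofReal (‖weylSum (fun n => u n x) (k ^ 4)‖ ^ 2) ∂μ ≠ ⊤ := by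
    rw [lintegral_tsum hmeas]
    have hsum : Summable fun k : ℕ => C * (1 / (k : ℝ) ^ 2) :=
      (Real.summable_one_div_nat_pow.2 one_lt_two).mul_left C
    refine ne_top_of_le_ne_top hsum.tsum_ofReal_ne_top (ENNReal.tsum_le_tsum fun k => ?_)
    rw [← ofReal_integral_eq_lintegral_ofReal (hint k) (ae_of_all _ fun x => by positivity)]
    refine ENNReal.ofReal_le_ofReal ?_
    rw [integral_Icc_eq_integral_Ioc, ← intervalIntegral.integral_of_le zero_le_one]
    exact hC k
  filter_upwards [ae_lt_top' (AEMeasurable.tsum hmeas) hfin] with x hx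
  have h1 := ENNReal.tendsto_atTop_zero_of_tsum_ne_top hx.ne
  have h2 := (ENNReal.tendsto_toReal ENNReal.zero_ne_top).comp h1
  have h3 : Tendsto (fun k : ℕ => ‖weylSum (fun n => u n x) (k ^ 4)‖ ^ 2) atTop (nhds 0) := by
    refine h2.congr fun k => ?_
    simp
  have h4 := h3.sqrt
  rw [tendsto_zero_iff_norm_tendsto_zero]
  simpa using h4

theorem tendsto_weylSum_of_tendsto_pow_four {y : ℕ → ℝ}
    (h : Tendsto (fun k : ℕ => weylSum y (k ^ 4)) atTop (nhds 0)) :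
    Tendsto (weylSum y) atTop (nhds 0) := by
  set r : ℕ → ℕ := fun N => Nat.sqrt (Nat.sqrt N) with hr
  have hle : ∀ N, r N ^ 4 ≤ N := fun N => by
    have h1 := Nat.sqrt_le' N
    have h2 := Nat.sqrt_le' (Nat.sqrt N)
    calc r N ^ 4 = (Nat.sqrt (Nat.sqrt N) ^ 2) ^ 2 := by rw [← pow_mul]
      _ ≤ Nat.sqrt N ^ 2 := Nat.pow_le_pow_left h2 2
      _ ≤ N := h1
  have hlt : ∀ N, N < (r N + 1) ^ 4 := fun N => by
    have h1 := Nat.lt_succ_sqrt' N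
    have h2 := Nat.lt_succ_sqrt' (Nat.sqrt N)
    calc N < (Nat.sqrt N + 1) ^ 2 := h1
      _ ≤ ((Nat.sqrt (Nat.sqrt N) + 1) ^ 2) ^ 2 := Nat.pow_le_pow_left h2 2
      _ = (r N + 1) ^ 4 := by rw [← pow_mul]
  have hrtop : Tendsto r atTop atTop := by
    refine tendsto_atTop.2 fun b => ?_
    filter_upwards [eventually_ge_atTop (b ^ 4)] with N hN
    by_contra! hcon
    exact absurd (hlt N) (not_lt.2 ((Nat.pow_le_pow_left hcon 4).trans hN))
  have hbound : ∀ᶠ N in atTop, ‖weylSum y N‖ ≤ ‖weylSum y (r N ^ 4)‖ + 15 * (1 / (r N : ℝ)) := by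
    filter_upwards [hrtop.eventually_ge_atTop 1] with N hN
    have hk : (1 : ℝ) ≤ r N := by exact_mod_cast hN
    have hkN : ((r N : ℝ)) ^ 4 ≤ N := by exact_mod_cast hle N
    have hkN' : (N : ℝ) ≤ ((r N : ℝ) + 1) ^ 4 := by exact_mod_cast (hlt N).le
    have hk4 : (0 : ℝ) < (r N : ℝ) ^ 4 := by positivity
    have hN0 : (0 : ℝ) < N := hk4.trans_le hkN
    have hsplit : ∑ j ∈ Finset.Icc 1 N, expi (y j)
        = ∑ j ∈ Finset.Icc 1 (r N ^ 4), expi (y j) + ∑ j ∈ Finset.Ioc (r N ^ 4) N, expi (y j) := by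
      rw [← Finset.sum_union]
      · congr 1
        ext j
        have := hle N
        simp only [Finset.mem_union, Finset.mem_Icc, Finset.mem_Ioc]
        have : 1 ≤ r N ^ 4 := Nat.one_le_pow _ _ hN
        omega
      · refine Finset.disjoint_left.2 fun j h1 h2 => ?_
        simp only [Finset.mem_Icc, Finset.mem_Ioc] at h1 h2
        omega
    have htail : ‖∑ j ∈ Finset.Ioc (r N ^ 4) N, expi (y j)‖ ≤ 15 * (r N : ℝ) ^ 3 := by
      refine (norm_sum_le _ _).trans ?_
      simp only [norm_expi, Finset.sum_const, Nat.card_Ioc, nsmul_eq_mul, mul_one]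
      rw [Nat.cast_sub (hle N)]
      push_cast
      have h2 : (1 : ℝ) ≤ (r N : ℝ) ^ 2 := one_le_pow₀ hk
      nlinarith [mul_le_mul_of_nonneg_left hk (by positivity : (0 : ℝ) ≤ (r N : ℝ) ^ 2)]
    have hnorm : ∀ n : ℕ, ‖weylSum y n‖ = (n : ℝ)⁻¹ * ‖∑ j ∈ Finset.Icc 1 n, expi (y j)‖ :=
      fun n => by simp [weylSum]
    have hinv : (N : ℝ)⁻¹ ≤ ((r N : ℝ) ^ 4)⁻¹ := inv_anti₀ hk4 hkN
    rw [hnorm, hnorm, hsplit]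
    push_cast
    calc _ ≤ ((r N : ℝ) ^ 4)⁻¹ * (‖∑ j ∈ Finset.Icc 1 (r N ^ 4), expi (y j)‖ + 15 * (r N : ℝ) ^ 3) :=
          mul_le_mul hinv ((norm_add_le _ _).trans (add_le_add le_rfl htail)) (norm_nonneg _)
            (by positivity)
      _ = _ := by field_simp
  refine squeeze_zero_norm' hbound ?_
  have h1 : Tendsto (fun N => ‖weylSum y (r N ^ 4)‖) atTop (nhds 0) := by
    simpa using (h.comp hrtop).norm
  have h2 : Tendsto (fun N => 15 * (1 / (r N : ℝ))) atTop (nhds (15 * 0)) :=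
    ((tendsto_one_div_atTop_nhds_zero_nat (𝕜 := ℝ)).comp hrtop).const_mul 15
  simpa using h1.add h2

theorem fourier_coe_eq_expi (k : ℤ) (x : ℝ) : fourier k (x : UnitAddCircle) = expi (k * x) := by
  rw [fourier_coe_apply, expi]
  congr 1
  push_cast
  ring

theorem integral_expi_int_mul {k : ℤ} (hk : k ≠ 0) : ∫ x in (0 : ℝ)..1, expi (k * x) = 0 := by
  have hc : (2 * Real.pi * Complex.I * k : ℂ) ≠ 0 := by simp [Real.pi_ne_zero, hk]
  have h : ∀ x : ℝ, expi (k * x) = Complex.exp (2 * Real.pi * Complex.I * k * x) := fun x => by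
    rw [expi]; congr 1; push_cast; ring
  simp_rw [h]
  rw [integral_exp_mul_complex hc]
  have h1 : Complex.exp (2 * Real.pi * Complex.I * k) = 1 := by
    rw [mul_comm]; exact Complex.exp_int_mul_two_pi_mul_I k
  simp [h1]

theorem tendsto_average_of_forall_tendsto_weylSum {y : ℕ → ℝ}
    (h : ∀ k : ℤ, k ≠ 0 → Tendsto (weylSum fun n => k * y n) atTop (nhds 0))
    (f : C(UnitAddCircle, ℂ)) :
    Tendsto (fun N : ℕ => (1 / (N : ℂ)) * ∑ j ∈ Finset.Icc 1 N, f (y j)) atTop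
      (nhds (∫ x in (0 : ℝ)..1, f x)) := by
  have hint : ∀ g : C(UnitAddCircle, ℂ),
      IntervalIntegrable (fun x : ℝ => g x) volume 0 1 := fun g =>
    (g.continuous.comp (AddCircle.continuous_mk' 1)).intervalIntegrable _ _
  have hspan : ∀ p ∈ Submodule.span ℂ (Set.range (fourier (T := 1))),
      Tendsto (fun N : ℕ => (1 / (N : ℂ)) * ∑ j ∈ Finset.Icc 1 N, p (y j)) atTop
        (nhds (∫ x in (0 : ℝ)..1, p x)) := by
    intro p hp
    induction hp using Submodule.span_induction with
    | mem p hp =>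
      obtain ⟨k, rfl⟩ := hp
      simp only [fourier_coe_eq_expi]
      by_cases hk : k = 0
      · subst hk
        have h1 : ∀ N : ℕ, 1 ≤ N →
            (1 / (N : ℂ)) * ∑ j ∈ Finset.Icc 1 N, expi (((0 : ℤ) : ℝ) * y j) = 1 := fun N hN => by
          have : (N : ℂ) ≠ 0 := by exact_mod_cast (Nat.one_le_iff_ne_zero.1 hN)
          simp [expi, this]
        have h2 : ∫ x in (0 : ℝ)..1, expi (((0 : ℤ) : ℝ) * x) = 1 := by simp [expi]
        rw [h2]
        exact tendsto_const_nhds.congr' ((eventually_ge_atTop 1).mono fun N hN => (h1 N hN).symm)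
      · rw [integral_expi_int_mul hk]
        exact h k hk
    | zero => simp
    | add p q _ _ hp hq =>
      simp only [ContinuousMap.add_apply, Finset.sum_add_distrib, mul_add]
      rw [intervalIntegral.integral_add (hint p) (hint q)]
      exact hp.add hq
    | smul c p _ hp =>
      simp only [ContinuousMap.smul_apply, smul_eq_mul, ← Finset.mul_sum, mul_left_comm _ c]
      rw [intervalIntegral.integral_const_mul]
      exact hp.const_mul c
  have hf : f ∈ closure (Submodule.span ℂ (Set.range (fourier (T := 1))) : Set C(UnitAddCircle, ℂ)) := by
    rw [← Submodule.topologicalClosure_coe, span_fourier_closure_eq_top]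
    trivial
  rw [Metric.tendsto_atTop]
  intro ε hε
  obtain ⟨p, hp, hfp⟩ := Metric.mem_closure_iff.1 hf (ε / 3) (by positivity)
  obtain ⟨N₀, hN₀⟩ := Metric.tendsto_atTop.1 (hspan p hp) (ε / 3) (by positivity)
  refine ⟨N₀, fun N hN => ?_⟩
  rw [dist_eq_norm] at hfp
  have hpt : ∀ x, ‖f x - p x‖ ≤ ‖f - p‖ := fun x => (f - p).norm_coe_le_norm x
  have h1 : ‖(1 / (N : ℂ)) * ∑ j ∈ Finset.Icc 1 N, f (y j)
      - (1 / (N : ℂ)) * ∑ j ∈ Finset.Icc 1 N, p (y j)‖ ≤ ‖f - p‖ := by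
    rw [← mul_sub, ← Finset.sum_sub_distrib, norm_mul]
    have h2 : ‖∑ j ∈ Finset.Icc 1 N, (f (y j) - p (y j))‖ ≤ N * ‖f - p‖ := by
      refine (norm_sum_le_of_le _ fun j _ => hpt (y j)).trans_eq ?_
      simp
    rcases Nat.eq_zero_or_pos N with rfl | hN
    · simp
    have hN' : (0 : ℝ) < N := by exact_mod_cast hN
    calc _ ≤ ‖(1 / (N : ℂ))‖ * (N * ‖f - p‖) := by gcongr
      _ = _ := by simp; field_simp
  have h3 : ‖(∫ x in (0 : ℝ)..1, p x) - ∫ x in (0 : ℝ)..1, f x‖ ≤ ‖f - p‖ := by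
    rw [← intervalIntegral.integral_sub (hint p) (hint f)]
    refine (intervalIntegral.norm_integral_le_of_norm_le_const fun x _ =>
      (norm_sub_rev _ _).trans_le (hpt x)).trans_eq ?_
    simp
  have h4 := hN₀ N hN
  rw [dist_eq_norm] at h4 ⊢
  calc _ = ‖((1 / (N : ℂ)) * ∑ j ∈ Finset.Icc 1 N, f (y j)
          - (1 / (N : ℂ)) * ∑ j ∈ Finset.Icc 1 N, p (y j))
        + ((1 / (N : ℂ)) * ∑ j ∈ Finset.Icc 1 N, p (y j) - ∫ x in (0 : ℝ)..1, p x)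
        + ((∫ x in (0 : ℝ)..1, p x) - ∫ x in (0 : ℝ)..1, f x)‖ := by congr 1; ring
    _ ≤ _ := norm_add₃_le
    _ < ε := by linarith

theorem coe_fract_unitAddCircle (x : ℝ) : ((Int.fract x : ℝ) : UnitAddCircle) = x := by
  rw [← Int.self_sub_floor, AddCircle.coe_sub, sub_eq_self]
  exact AddCircle.coe_eq_zero_iff 1 |>.2 ⟨⌊x⌋, by simp⟩

/-- The proportion of `y 1, …, y N` whose fractional part lies in `[a, b)`. -/
noncomputable def fractFreq (y : ℕ → ℝ) (a b : ℝ) (N : ℕ) : ℝ :=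
  (((Finset.Icc 1 N).filter (fun n => Int.fract (y n) ∈ Set.Ico a b)).card : ℝ) / N

theorem eventually_sub_le_fractFreq {y : ℕ → ℝ}
    (h : ∀ k : ℤ, k ≠ 0 → Tendsto (weylSum fun n => k * y n) atTop (nhds 0))
    {a b ε : ℝ} (ha : 0 ≤ a) (hb : b ≤ 1) (hε : 0 < ε) :
    ∀ᶠ N in atTop, b - a - ε ≤ fractFreq y a b N := by
  have hnonneg : ∀ N, 0 ≤ fractFreq y a b N := fun N => by unfold fractFreq; positivity
  rcases le_total (b - a) ε with hle | hle
  · exact Eventually.of_forall fun N => (sub_nonpos.2 hle).trans (hnonneg N)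
  set δ : ℝ := ε / 4 with hδ
  have hδ0 : 0 < δ := by positivity
  set g : ℝ → ℝ := fun x => max 0 (min 1 (min ((x - a) / δ) ((b - x) / δ))) with hg
  have hgc : Continuous g := by fun_prop
  have hg0 : ∀ x, 0 ≤ g x := fun x => le_max_left _ _
  have hg1 : ∀ x, g x ≤ 1 := fun x => max_le zero_le_one (min_le_left _ _)
  have hleft : ∀ x, x ≤ a → g x = 0 := fun x hx =>
    max_eq_left ((min_le_right _ _).trans ((min_le_left _ _).trans
      (div_nonpos_of_nonpos_of_nonneg (by linarith) hδ0.le)))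
  have hright : ∀ x, b ≤ x → g x = 0 := fun x hx =>
    max_eq_left ((min_le_right _ _).trans ((min_le_right _ _).trans
      (div_nonpos_of_nonpos_of_nonneg (by linarith) hδ0.le)))
  have hmid : ∀ x ∈ Set.Icc (a + δ) (b - δ), g x = 1 := fun x hx => by
    have h1 : 1 ≤ (x - a) / δ := by rw [le_div_iff₀ hδ0]; linarith [hx.1]
    have h2 : 1 ≤ (b - x) / δ := by rw [le_div_iff₀ hδ0]; linarith [hx.2]
    simp only [hg]
    rw [min_eq_left (le_min h1 h2), max_eq_right zero_le_one]
  have hend : (g 0 : ℂ) = g 1 := by rw [hleft 0 ha, hright 1 hb]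
  set G : C(UnitAddCircle, ℂ) := ⟨AddCircle.liftIco 1 0 fun x => (g x : ℂ),
    AddCircle.liftIco_zero_continuous hend
      (Complex.continuous_ofReal.comp hgc).continuousOn⟩ with hG
  have hGapply : ∀ x ∈ Set.Ico (0 : ℝ) 1, G (x : UnitAddCircle) = g x := fun x hx =>
    AddCircle.liftIco_zero_coe_apply (p := 1) (f := fun x => (g x : ℂ)) hx
  have hGfract : ∀ x : ℝ, G (x : UnitAddCircle) = g (Int.fract x) := fun x => by
    rw [← coe_fract_unitAddCircle, hGapply _ ⟨Int.fract_nonneg x, Int.fract_lt_one x⟩]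
  have hGint : ∫ x in (0 : ℝ)..1, G (x : UnitAddCircle) = ((∫ x in (0 : ℝ)..1, g x : ℝ) : ℂ) := by
    rw [← intervalIntegral.integral_ofReal]
    refine intervalIntegral.integral_congr fun x hx => ?_
    rw [Set.uIcc_of_le zero_le_one] at hx
    rcases hx.2.lt_or_eq with hlt | rfl
    · exact hGapply x ⟨hx.1, hlt⟩
    · simp only [hGfract, Int.fract_one]
      exact hend
  have hgint : b - a - ε / 2 ≤ ∫ x in (0 : ℝ)..1, g x := by
    have h1 : ∫ x in (a + δ)..(b - δ), g x = b - a - ε / 2 := by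
      have : ∫ x in (a + δ)..(b - δ), g x = ∫ x in (a + δ)..(b - δ), (1 : ℝ) :=
        intervalIntegral.integral_congr fun x hx => hmid x (by
          rwa [Set.uIcc_of_le (by linarith)] at hx)
      rw [this, intervalIntegral.integral_const, smul_eq_mul, mul_one]
      ring
    rw [← h1]
    exact intervalIntegral.integral_mono_interval (by linarith) (by linarith) (by linarith)
      (ae_of_all _ hg0) (hgc.intervalIntegrable _ _)
  have hlim := tendsto_average_of_forall_tendsto_weylSum h G
  rw [hGint] at hlim
  have hlim' := (Complex.continuous_re.tendsto _).comp hlim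
  rw [Complex.ofReal_re] at hlim'
  filter_upwards [hlim'.eventually_const_lt (u := b - a - ε) (by linarith)] with N hN
  refine hN.le.trans ?_
  have hre : (Complex.re ∘ fun N : ℕ => (1 / (N : ℂ)) * ∑ j ∈ Finset.Icc 1 N, G (y j)) N
      = (∑ j ∈ Finset.Icc 1 N, g (Int.fract (y j))) / N := by
    simp only [Function.comp_apply, hGfract]
    rw [← Complex.ofReal_sum, ← Complex.ofReal_natCast, one_div, ← Complex.ofReal_inv,
      ← Complex.ofReal_mul, Complex.ofReal_re, div_eq_inv_mul]
  rw [hre, fractFreq, Finset.card_filter]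
  push_cast
  gcongr with j hj
  split_ifs with hmem
  · exact hg1 _
  · rw [Set.mem_Ico, not_and_or, not_le, not_lt] at hmem
    rcases hmem with hlt | hge
    · exact (hleft _ hlt.le).le
    · exact (hright _ hge).le

theorem fractFreq_add_add_le_one (y : ℕ → ℝ) (a b : ℝ) (hab : a ≤ b) (N : ℕ) :
    fractFreq y 0 a N + fractFreq y a b N + fractFreq y b 1 N ≤ 1 := by
  unfold fractFreq
  rw [← add_div, ← add_div]
  refine div_le_one_of_le₀ ?_ (Nat.cast_nonneg N)
  simp only [Finset.card_filter]
  push_cast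
  rw [← Finset.sum_add_distrib, ← Finset.sum_add_distrib]
  calc _ ≤ ∑ j ∈ Finset.Icc 1 N, (1 : ℝ) := Finset.sum_le_sum fun j _ => by
        simp only [Set.mem_Ico]
        split_ifs with h1 h2 h3 h3 h2 h3 h3 <;> first | (exfalso; linarith) | norm_num
    _ = N := by simp

/-- Weyl's criterion: vanishing exponential averages imply uniform distribution modulo 1. -/
theorem udMod1_of_forall_tendsto_weylSum {y : ℕ → ℝ}
    (h : ∀ k : ℤ, k ≠ 0 → Tendsto (weylSum fun n => k * y n) atTop (nhds 0)) : UDMod1 y := by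
  intro a b ha hab hb
  change Tendsto (fractFreq y a b) atTop (nhds (b - a))
  rw [Metric.tendsto_nhds]
  intro ε hε
  filter_upwards [eventually_sub_le_fractFreq h ha hb (by positivity : 0 < ε / 3),
    eventually_sub_le_fractFreq h le_rfl (hab.le.trans hb) (by positivity : 0 < ε / 3),
    eventually_sub_le_fractFreq h (ha.trans hab.le) le_rfl (by positivity : 0 < ε / 3)]
    with N h1 h2 h3
  have h4 := fractFreq_add_add_le_one y a b hab.le N
  rw [Real.dist_eq, abs_lt]
  constructor <;> linarith

/-- Koksma's General Metric Theorem. -/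
theorem stmt1 (K : ℝ) (hK : 0 < K) (u : ℕ → ℝ → ℝ) (hu : IsKoksma K u) :
    ∀ᵐ x ∂(volume.restrict (Set.Icc (0:ℝ) 1)), UDMod1 (fun n => u n x) := by
  have h : ∀ᵐ x ∂(volume.restrict (Set.Icc (0:ℝ) 1)), ∀ k : ℤ, k ≠ 0 →
      Tendsto (weylSum fun n => k * u n x) atTop (nhds 0) := by
    refine ae_all_iff.2 fun k => ?_
    by_cases hk : k = 0
    · exact ae_of_all _ fun x hk' => absurd hk hk'
    · have hk' : 0 < |(k : ℝ)| := abs_pos.2 (Int.cast_ne_zero.2 hk)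
      filter_upwards [(hu.const_mul k).ae_tendsto_weylSum_pow_four (mul_pos hk' hK)] with x hx _
      exact tendsto_weylSum_of_tendsto_pow_four hx
  filter_upwards [h] with x hx
  exact udMod1_of_forall_tendsto_weylSum hx
end

section
/- For every sequence (x_n)_{n≥1} of real numbers, the set A = [0,1) ∩ ⋃_{n≥1} (frac(x_n) − 2^{−n−2}, frac(x_n) + 2^{−n−2}) is open in [0,1), satisfies λ(A) ≤ 1/2, and contains frac(x_n) for every n ≥ 1; consequently, if a class C of Lebesgue-measurable subsets of [0,1] contains all subsets of [0,1) that are open in [0,1), then no sequence of reals is C-uniformly distributed. -/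
open MeasureTheory Filter Finset
open scoped Classical

/-- The union of the intervals of radius `2 ^ (-n - 2)` around `c n`, `n ≥ 1`. -/
def shrinkingIntervals (c : ℕ → ℝ) : Set ℝ :=
  ⋃ n ∈ {n : ℕ | 1 ≤ n}, Set.Ioo (c n - 2 ^ (-(n:ℤ) - 2)) (c n + 2 ^ (-(n:ℤ) - 2))

theorem isOpen_shrinkingIntervals (c : ℕ → ℝ) : IsOpen (shrinkingIntervals c) :=
  isOpen_biUnion fun _ _ => isOpen_Ioo

theorem mem_shrinkingIntervals (c : ℕ → ℝ) {n : ℕ} (hn : 1 ≤ n) :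
    c n ∈ shrinkingIntervals c := by
  have h : (0:ℝ) < 2 ^ (-(n:ℤ) - 2) := by positivity
  exact Set.mem_biUnion (show n ∈ {n : ℕ | 1 ≤ n} from hn) ⟨by linarith, by linarith⟩

theorem volume_shrinkingIntervals_le (c : ℕ → ℝ) :
    volume (shrinkingIntervals c) ≤ 1 / 2 := by
  have hsub : shrinkingIntervals c ⊆ ⋃ k : ℕ, Set.Ioo
      (c (k + 1) - 2 ^ (-((k + 1 : ℕ) : ℤ) - 2)) (c (k + 1) + 2 ^ (-((k + 1 : ℕ) : ℤ) - 2)) := by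
    refine Set.iUnion₂_subset fun n hn => ?_
    obtain ⟨k, rfl⟩ := Nat.exists_eq_add_of_le' (show 1 ≤ n from hn)
    exact Set.subset_iUnion_of_subset k subset_rfl
  have hlen (k : ℕ) : volume (Set.Ioo (c (k + 1) - 2 ^ (-((k + 1 : ℕ) : ℤ) - 2))
      (c (k + 1) + 2 ^ (-((k + 1 : ℕ) : ℤ) - 2))) = ENNReal.ofReal (1 / 4 * (1 / 2) ^ k) := by
    rw [Real.volume_Ioo]
    congr 1
    have h : (2:ℝ) ^ (-((k + 1 : ℕ) : ℤ) - 2) = 1 / 8 * (1 / 2) ^ k := by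
      rw [show -((k + 1 : ℕ) : ℤ) - 2 = -(k:ℤ) + (-3) by push_cast; ring,
        zpow_add₀ two_ne_zero, zpow_neg, zpow_natCast, one_div_pow]
      norm_num
      ring
    rw [h]
    ring
  calc volume (shrinkingIntervals c)
      ≤ ∑' k : ℕ, ENNReal.ofReal (1 / 4 * (1 / 2) ^ k) :=
        (measure_mono hsub).trans ((measure_iUnion_le _).trans_eq (tsum_congr hlen))
    _ = ENNReal.ofReal (1 / 2) := by
        rw [← ENNReal.ofReal_tsum_of_nonneg (fun k => by positivity)
          (summable_geometric_two.mul_left _), tsum_mul_left, tsum_geometric_two]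
        norm_num
    _ = 1 / 2 := by
        rw [ENNReal.ofReal_div_of_pos two_pos]
        simp

theorem fract_mem_Ico_inter_shrinkingIntervals (x : ℕ → ℝ) {n : ℕ} (hn : 1 ≤ n) :
    Int.fract (x n) ∈ Set.Ico 0 1 ∩ shrinkingIntervals fun n => Int.fract (x n) :=
  ⟨⟨Int.fract_nonneg _, Int.fract_lt_one _⟩,
    mem_shrinkingIntervals (fun n => Int.fract (x n)) hn⟩

theorem volume_Ico_inter_shrinkingIntervals_le (c : ℕ → ℝ) :
    volume (Set.Ico 0 1 ∩ shrinkingIntervals c) ≤ 1 / 2 :=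
  (measure_mono Set.inter_subset_right).trans (volume_shrinkingIntervals_le c)

/-- A `C`-u.d. sequence cannot stay inside a member of `C` of measure less than `1`. -/
theorem CUD.volume_toReal_eq_one {C : Set (Set ℝ)} {y : ℕ → ℝ} (hy : CUD C y) {B : Set ℝ}
    (hB : B ∈ C) (hmem : ∀ n, 1 ≤ n → Int.fract (y n) ∈ B) : (volume B).toReal = 1 := by
  refine tendsto_nhds_unique (hy B hB) (tendsto_const_nhds.congr' ?_)
  filter_upwards [eventually_ge_atTop 1] with N hN
  rw [Finset.filter_true_of_mem fun n hn => hmem n (Finset.mem_Icc.1 hn).1, Nat.card_Icc,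
    Nat.add_sub_cancel, div_self (by positivity)]

/-- The set `A = [0,1) ∩ ⋃_{n≥1} (frac (x n) - 2^{-n-2}, frac (x n) + 2^{-n-2})` is open
in `[0,1)`, has measure at most `1/2` and contains every `frac (x n)`, `n ≥ 1`;
consequently if a class `C` of measurable subsets of `[0,1]` contains all subsets of
`[0,1)` open in `[0,1)`, then no sequence is `C`-u.d. -/
theorem stmt3 (x : ℕ → ℝ) (A : Set ℝ)
    (hA : A = Set.Ico 0 1 ∩ ⋃ n ∈ {n : ℕ | 1 ≤ n},
        Set.Ioo (Int.fract (x n) - 2 ^ (-(n:ℤ) - 2)) (Int.fract (x n) + 2 ^ (-(n:ℤ) - 2))) :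
    (∃ U : Set ℝ, IsOpen U ∧ A = U ∩ Set.Ico 0 1) ∧
    volume A ≤ 1/2 ∧
    (∀ n, 1 ≤ n → Int.fract (x n) ∈ A) ∧
    (∀ C : Set (Set ℝ), (∀ B ∈ C, MeasurableSet B ∧ B ⊆ Set.Icc (0:ℝ) 1) →
      (∀ B, B ⊆ Set.Ico (0:ℝ) 1 → (∃ U, IsOpen U ∧ B = U ∩ Set.Ico (0:ℝ) 1) → B ∈ C) →
      ∀ y : ℕ → ℝ, ¬ CUD C y) := by
  subst hA
  refine ⟨⟨_, isOpen_shrinkingIntervals fun n => Int.fract (x n), Set.inter_comm _ _⟩,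
    volume_Ico_inter_shrinkingIntervals_le _,
    fun n hn => fract_mem_Ico_inter_shrinkingIntervals x hn, fun C _ hC y hy => ?_⟩
  have h1 := hy.volume_toReal_eq_one
    (hC _ Set.inter_subset_left ⟨_, isOpen_shrinkingIntervals _, Set.inter_comm _ _⟩)
    fun n hn => fract_mem_Ico_inter_shrinkingIntervals y hn
  have h2 := ENNReal.toReal_mono (by simp)
    (volume_Ico_inter_shrinkingIntervals_le fun n => Int.fract (y n))
  rw [h1] at h2
  norm_num at h2
end
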